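/- Given a pushdown automaton with output A and a state q of A, the set I_{A,q} = {(w, m) : (q0, ε, 0) →* (q, w, m)} is rational, and an automaton recognizing it can be effectively constructed from A. -/

import Mathlib

/-!
Formalization of context-bounded liveness for dynamic networks of concurrent
pushdown systems (DCPS) and VASS with balloons (VASSB).
Global states, stack symbols, places, balloon states etc. are drawn from ℕ;
the finite components of the systems are recorded as `Finset`s.
-/

noncomputable section

namespace CBL

/-! ### Vectors over a finite output alphabet -/

/-- A vector in `ℕ^Λ` (finitely supported, letters drawn from `ℕ`). -/
abbrev Vec : Type := ℕ →₀ ℕ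

def encodeVec (v : Vec) : ℕ := Encodable.encode v.graph.val

/-! ### Pushdown automata with output and rational subsets of `Γ* × ℕ^Λ` -/

/-- Stack action of an edge: `none` is `ε`, `some (false, γ)` pushes `γ`,
`some (true, γ)` pops `γ` (i.e. reads `γ̄`). -/
abbrev PLabel : Type := Option (Bool × ℕ)

/-- A pushdown automaton with output `(Q, Γ, Λ, E, q0, q_f)`. -/
structure PDAO where
  states : Finset ℕ
  alph : Finset ℕ
  out : Finset ℕ
  edges : Finset (ℕ × PLabel × Vec × ℕ)
  q0 : ℕ
  qf : ℕ

/-- A configuration `(q, w, m)` of a pushdown automaton with output. -/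
abbrev PConf : Type := ℕ × List ℕ × Vec

/-- One step of the pushdown automaton with output `A`. -/
def PStep (A : PDAO) (c c' : PConf) : Prop :=
  ∃ e ∈ A.edges, c.1 = e.1 ∧ c'.1 = e.2.2.2 ∧ c'.2.2 = c.2.2 + e.2.2.1 ∧
    (match e.2.1 with
     | none => c'.2.1 = c.2.1
     | some (false, gam) => c'.2.1 = c.2.1 ++ [gam]
     | some (true, gam) => c.2.1 = c'.2.1 ++ [gam])

def PReach (A : PDAO) : PConf → PConf → Prop := Relation.ReflTransGen (PStep A)

/-- `S_{A,q} = {(w, m) : (q0, ε, 0) →* (q, w, m') →* (q_f, ε, m)}`. -/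
def SSet (A : PDAO) (q : ℕ) : Set (List ℕ × Vec) :=
  {wm | ∃ m' : Vec, PReach A (A.q0, [], 0) (q, wm.1, m') ∧
        PReach A (q, wm.1, m') (A.qf, [], wm.2)}

/-- `I_{A,q} = {(w, m) : (q0, ε, 0) →* (q, w, m)}`. -/
def ISet (A : PDAO) (q : ℕ) : Set (List ℕ × Vec) :=
  {wm | PReach A (A.q0, [], 0) (q, wm.1, wm.2)}

/-- A finite automaton over `Γ* × ℕ^Λ`: edges are labelled by pairs
`(u, m) ∈ Γ* × ℕ^Λ`. -/
structure RatAut where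
  states : Finset ℕ
  edges : Finset (ℕ × (List ℕ × Vec) × ℕ)
  q0 : ℕ
  final : Finset ℕ

/-- One step of the automaton: concatenate the word label, add the vector
label. -/
def RStep (B : RatAut) (c c' : ℕ × List ℕ × Vec) : Prop :=
  ∃ e ∈ B.edges, c.1 = e.1 ∧ c'.1 = e.2.2 ∧
    c'.2.1 = c.2.1 ++ e.2.1.1 ∧ c'.2.2 = c.2.2 + e.2.1.2

/-- The set of labels of accepting runs of `B`; a subset of `Γ* × ℕ^Λ` is
rational iff it is of this form. -/
def RLang (B : RatAut) : Set (List ℕ × Vec) :=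
  {wm | ∃ qf ∈ B.final, Relation.ReflTransGen (RStep B) (B.q0, [], 0) (qf, wm.1, wm.2)}

/-- An effective encoding of pushdown automata with output. -/
def encodePDAO (A : PDAO) : ℕ :=
  Encodable.encode (A.states.val, A.alph.val, A.out.val,
    A.edges.val.map (fun e => (e.1, Encodable.encode e.2.1, encodeVec e.2.2.1, e.2.2.2)),
    A.q0, A.qf)

/-- An effective encoding of finite automata over `Γ* × ℕ^Λ`. -/
def encodeRatAut (B : RatAut) : ℕ :=
  Encodable.encode (B.states.val,
    B.edges.val.map (fun e => (e.1, e.2.1.1, encodeVec e.2.1.2, e.2.2)),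
    B.q0, B.final.val)

section Grammar

variable {V M : Type*} [AddCommMonoid M] {R : V → M → Multiset V → Prop}

/-- Derivations of the commutative grammar `R` that rewrite letters of `S` only. -/
inductive Der (R : V → M → Multiset V → Prop) (S : Finset V) :
    Multiset V → Multiset V → M → Prop
  | refl (α : Multiset V) : Der R S α α 0
  | head {X : V} {u m : M} {γ α β : Multiset V} :
      R X u γ → X ∈ S → Der R S (γ + α) β m → Der R S (X ::ₘ α) β (u + m)

namespace Der

variable {S : Finset V} {α β α' β' : Multiset V} {m m' : M}

theorem add (h : Der R S α β m) (h' : Der R S α' β' m') :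
    Der R S (α + α') (β + β') (m + m') := by
  induction h with
  | refl α =>
    rw [zero_add]
    induction h' with
    | refl => exact .refl _
    | @head X u m γ α' β hR hX _ ih =>
      rw [Multiset.add_cons]
      refine .head hR hX ?_
      rwa [add_left_comm]
  | @head X u m γ α β hR hX _ ih =>
    rw [Multiset.cons_add, add_assoc]
    refine .head hR hX ?_
    rwa [← add_assoc]

theorem split (h : Der R S (α + α') β m) : ∃ β₁ β₂ m₁ m₂,
    Der R S α β₁ m₁ ∧ Der R S α' β₂ m₂ ∧ β = β₁ + β₂ ∧ m = m₁ + m₂ := by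
  generalize hσ : α + α' = σ at h
  induction h generalizing α α' with
  | refl σ => exact ⟨α, α', 0, 0, .refl _, .refl _, hσ.symm, by simp⟩
  | @head X u m γ σ β hR hX _ ih =>
    have hmem : X ∈ α + α' := hσ ▸ Multiset.mem_cons_self _ _
    rcases Multiset.mem_add.1 hmem with h | h
    · obtain ⟨ρ, rfl⟩ := Multiset.exists_cons_of_mem h
      rw [Multiset.cons_add, Multiset.cons_inj_right] at hσ
      obtain ⟨β₁, β₂, m₁, m₂, h₁, h₂, rfl, rfl⟩ :=
        ih (α := γ + ρ) (α' := α') (by rw [← hσ, add_assoc])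
      exact ⟨β₁, β₂, u + m₁, m₂, .head hR hX h₁, h₂, rfl, by rw [add_assoc]⟩
    · obtain ⟨ρ, rfl⟩ := Multiset.exists_cons_of_mem h
      rw [Multiset.add_cons, Multiset.cons_inj_right] at hσ
      obtain ⟨β₁, β₂, m₁, m₂, h₁, h₂, rfl, rfl⟩ :=
        ih (α := α) (α' := γ + ρ) (by rw [← hσ, add_left_comm])
      exact ⟨β₁, β₂, m₁, u + m₂, h₁, .head hR hX h₂, rfl, by rw [add_left_comm]⟩

end Der

variable [DecidableEq V]

/-- The number of occurrences of letters of `S` in `α`. -/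
def index (S : Finset V) (α : Multiset V) : ℕ := α.countP (· ∈ S)

theorem index_add (S : Finset V) (α β : Multiset V) :
    index S (α + β) = index S α + index S β := Multiset.countP_add _ _ _

theorem index_eq_zero {S : Finset V} {α : Multiset V} :
    index S α = 0 ↔ ∀ y ∈ α, y ∉ S := Multiset.countP_eq_zero

theorem index_le_card (S : Finset V) (α : Multiset V) : index S α ≤ α.card :=
  Multiset.countP_le_card _ _

theorem index_insert {S : Finset V} {X : V} (hX : X ∉ S) (α : Multiset V) :
    index (insert X S) α = index S α + α.count X := by
  induction α using Multiset.induction_on with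
  | empty => simp [index]
  | cons a α ih =>
    simp only [index, Multiset.countP_cons, Multiset.count_cons, Finset.mem_insert] at ih ⊢
    by_cases h : a = X
    · subst h; simp [hX, ih]; omega
    · simp [h, Ne.symm h, ih]; omega

/-- Derivations of the commutative grammar `R` that rewrite letters of `S` only, and in which
every sentential form has at most `k` occurrences of letters of `S`. -/
inductive BDer (R : V → M → Multiset V → Prop) (S : Finset V) (k : ℕ) :
    Multiset V → Multiset V → M → Prop
  | refl (α : Multiset V) : index S α ≤ k → BDer R S k α α 0
  | tail {X : V} {u m : M} {γ α δ : Multiset V} :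
      BDer R S k α (X ::ₘ δ) m → R X u γ → X ∈ S → index S (γ + δ) ≤ k →
      BDer R S k α (γ + δ) (m + u)

namespace BDer

variable {S : Finset V} {k : ℕ} {X : V} {α β δ : Multiset V} {m m' : M}

theorem mono {l : ℕ} (hkl : k ≤ l) (h : BDer R S k α β m) : BDer R S l α β m := by
  induction h with
  | refl α h => exact .refl _ (h.trans hkl)
  | tail _ hR hX hi ih => exact .tail ih hR hX (hi.trans hkl)

theorem trans (h : BDer R S k α β m) (h' : BDer R S k β δ m') : BDer R S k α δ (m + m') := by
  induction h' with
  | refl => rwa [add_zero]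
  | tail _ hR hX hi ih => rw [← add_assoc]; exact .tail (ih h) hR hX hi

theorem add_right {ρ : Multiset V} {r : ℕ} (h : BDer R S k α β m) (hr : index S ρ ≤ r) :
    BDer R S (k + r) (α + ρ) (β + ρ) m := by
  induction h with
  | refl α h => exact .refl _ (by rw [index_add]; omega)
  | tail _ hR hX hi ih =>
    rw [add_assoc]
    rw [Multiset.cons_add] at ih
    refine .tail ih hR hX ?_
    rw [← add_assoc, index_add]; omega

theorem single {u : M} {γ : Multiset V} (hR : R X u γ) (hX : X ∈ S) (hk : 1 ≤ k)
    (hγ : index S γ ≤ k) : BDer R S k {X} γ u := by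
  have := BDer.tail (k := k) (δ := 0) (.refl {X} ((index_le_card _ _).trans (by simpa))) hR hX
    (by simpa)
  simpa using this

/-- Allowing the rewriting of one more letter only raises the index by the final number of its
occurrences. -/
theorem insert_letter (hX : X ∉ S) (h : BDer R S k α β m) :
    BDer R (insert X S) (k + β.count X) α β m := by
  induction h with
  | refl α h => exact .refl _ (by rw [index_insert hX]; omega)
  | @tail Y u m γ α δ _ hR hY hi ih =>
    have hne : X ≠ Y := fun h => hX (h ▸ hY)
    refine .tail (ih.mono ?_) hR (Finset.mem_insert_of_mem hY) ?_
    · simp [Multiset.count_cons_of_ne hne]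
    · rw [index_insert hX]; omega

/-- Occurrences of `X` are rewritten one after the other by given derivations. -/
theorem rewrite_replicate {r : ℕ} (T : List (Multiset V × M))
    (hT : ∀ t ∈ T, BDer R S k {X} t.1 t.2 ∧ index S t.1 = 0) (ρ : Multiset V)
    (hr : index S (Multiset.replicate T.length X + ρ) ≤ r) :
    BDer R S (k + r) (Multiset.replicate T.length X + ρ) (ρ + (T.map Prod.fst).sum)
      (T.map Prod.snd).sum := by
  induction T generalizing ρ with
  | nil => simpa using BDer.refl ρ (by simp at hr; omega)
  | cons t T ih =>
    obtain ⟨ht, ht0⟩ := hT t (by simp)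
    have e : Multiset.replicate (t :: T).length X + ρ
        = {X} + (Multiset.replicate T.length X + ρ) := by
      rw [List.length_cons, Multiset.replicate_succ, Multiset.cons_add, Multiset.singleton_add]
    rw [e, index_add] at hr
    have h₁ := ht.add_right (ρ := Multiset.replicate T.length X + ρ) (r := r) (by omega)
    have h₂ := ih (fun t h => hT t (by simp [h])) (ρ + t.1)
      (by rw [← add_assoc, index_add, ht0]; omega)
    rw [e, List.map_cons, List.map_cons, List.sum_cons, List.sum_cons]
    refine h₁.trans ?_
    convert h₂ using 1 <;> abel

/-- Interleaving a derivation that does not rewrite `X` with given derivations rewriting most of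
the occurrences of `X` that it produces. -/
theorem rewrite_letter (hR : ∀ X u γ, R X u γ → γ.card ≤ 2) (hX : X ∉ S) {l c : ℕ}
    (h : BDer R S k α β m) (hα : α.card ≤ 2) (T : List (Multiset V × M))
    (hT : ∀ t ∈ T, BDer R (insert X S) l {X} t.1 t.2 ∧ index (insert X S) t.1 = 0)
    (β' : Multiset V) (hβ : β = Multiset.replicate T.length X + β') (hc : β'.count X ≤ c) :
    BDer R (insert X S) (l + (k + c + 2)) α (β' + (T.map Prod.fst).sum)
      (m + (T.map Prod.snd).sum) := by
  induction h generalizing T β' with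
  | refl α h =>
    rw [hβ, zero_add]
    refine rewrite_replicate T hT β' ?_
    rw [← hβ]
    have := index_le_card (insert X S) α
    omega
  | @tail Y u m γ α δ _ hRY hY hi ih =>
    have hne : X ≠ Y := fun h => hX (h ▸ hY)
    have hγ := hR _ _ _ hRY
    set t₁ := min T.length (δ.count X) with ht₁
    obtain ⟨δ', hδ'⟩ : ∃ δ', δ = Multiset.replicate t₁ X + δ' :=
      Multiset.le_iff_exists_add.1 (Multiset.le_count_iff_replicate_le.1 (min_le_right _ _))
    have hlen₁ : (T.take t₁).length = t₁ := by simp [ht₁]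
    have hcβ := congrArg (Multiset.count X) hβ
    have hcδ := congrArg (Multiset.count X) hδ'
    simp only [Multiset.count_add, Multiset.count_replicate_self] at hcβ hcδ
    have hcδ' : δ'.count X ≤ c := by omega
    have h₁ := ih hα (T.take t₁) (fun t h => hT t (List.mem_of_mem_take h)) (Y ::ₘ δ')
      (by rw [hlen₁, Multiset.add_cons, ← hδ']) (by rwa [Multiset.count_cons_of_ne hne])
    have hidx : index (insert X S) (γ + δ') ≤ k + c + 2 := by
      have h1 : index S (γ + δ') ≤ k := by
        rw [hδ', add_left_comm, index_add] at hi; omega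
      have h2 := Multiset.count_le_card X γ
      rw [index_insert hX, Multiset.count_add]; omega
    have hT0 : ∀ T' : List (Multiset V × M), (∀ t ∈ T', index (insert X S) t.1 = 0) →
        index (insert X S) (T'.map Prod.fst).sum = 0 := by
      intro T' h
      induction T' with
      | nil => simp [index]
      | cons t T' ih => simp [index_add, ih (fun t ht => h t (by simp [ht])), h t (by simp)]
    have hT0' := hT0 (T.take t₁) (fun t h => (hT t (List.mem_of_mem_take h)).2)
    rw [Multiset.cons_add] at h₁
    have h₂ := BDer.tail h₁ hRY (Finset.mem_insert_of_mem hY)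
      (by rw [← add_assoc, index_add, hT0']; omega)
    have e : γ + (δ' + ((T.take t₁).map Prod.fst).sum)
        = Multiset.replicate (T.drop t₁).length X + (β' + ((T.take t₁).map Prod.fst).sum) := by
      rw [← add_assoc, ← add_assoc]
      congr 1
      apply add_left_cancel (a := Multiset.replicate t₁ X)
      rw [add_left_comm, ← hδ', hβ, ← add_assoc, ← Multiset.replicate_add]
      congr 2
      simp; omega
    have h₃ := rewrite_replicate (r := k + c + 2) (T.drop t₁)
      (fun t h => hT t (List.mem_of_mem_drop h)) (β' + ((T.take t₁).map Prod.fst).sum)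
      (by rw [← e, ← add_assoc, index_add, hT0']; omega)
    rw [e] at h₂
    have h₄ := h₂.trans h₃
    have e₁ : (T.map Prod.fst).sum
        = ((T.take t₁).map Prod.fst).sum + ((T.drop t₁).map Prod.fst).sum := by
      rw [← List.sum_append, ← List.map_append, List.take_append_drop]
    have e₂ : (T.map Prod.snd).sum
        = ((T.take t₁).map Prod.snd).sum + ((T.drop t₁).map Prod.snd).sum := by
      rw [← List.sum_append, ← List.map_append, List.take_append_drop]
    rw [e₁, e₂]
    convert h₄ using 1
    · abel
    · abel

end BDer

/-- `p` is the outcome of a derivation that starts by rewriting `X` and goes on rewriting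
letters of `S` until none is left. -/
def IsPiece (R : V → M → Multiset V → Prop) (S : Finset V) (X : V) (p : Multiset V × M) : Prop :=
  ∃ u γ m, R X u γ ∧ Der R S γ p.1 m ∧ (∀ y ∈ p.1, y ∉ S) ∧ p.2 = u + m

/-- Cutting a derivation at the occurrences of `X`. -/
theorem Der.exists_pieces {S : Finset V} {X : V} {α β : Multiset V} {m : M}
    (h : Der R (insert X S) α β m) (hβ : ∀ y ∈ β, y ∉ insert X S) :
    ∃ δ m₀ P, Der R S α δ m₀ ∧ (∀ y ∈ δ, y ∉ S) ∧ (∀ p ∈ P, IsPiece R S X p) ∧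
      (δ.count X = 0 → P = []) ∧
      δ + (P.map Prod.fst).sum = Multiset.replicate P.length X + β ∧
      m = m₀ + (P.map Prod.snd).sum := by
  induction h with
  | refl α =>
    exact ⟨α, 0, [], .refl _, fun y hy hS => hβ y hy (Finset.mem_insert_of_mem hS), by simp,
      by simp, by simp, by simp⟩
  | @head Y u m γ α β hR hY _ ih =>
    obtain ⟨δ, m₀, P, hD, hδ, hP, h0, hsum, rfl⟩ := ih hβ
    by_cases hYS : Y ∈ S
    · exact ⟨δ, u + m₀, P, .head hR hYS hD, hδ, hP, h0, hsum, by rw [add_assoc]⟩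
    · obtain rfl : Y = X := by simpa [hYS] using hY
      obtain ⟨δ₁, δ₂, m₁, m₂, h₁, h₂, rfl, rfl⟩ := hD.split
      refine ⟨{Y} + δ₂, m₂, (δ₁, u + m₁) :: P, ?_, ?_, ?_, by simp, ?_, ?_⟩
      · have := (Der.refl (R := R) (S := S) {Y}).add h₂
        rwa [zero_add] at this
      · intro y hy
        rcases Multiset.mem_add.1 hy with hy | hy
        · rwa [Multiset.mem_singleton.1 hy]
        · exact hδ y (Multiset.mem_add.2 (.inr hy))
      · intro p hp
        rcases List.mem_cons.1 hp with rfl | hp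
        · exact ⟨u, γ, m₁, hR, h₁, fun y hy => hδ y (Multiset.mem_add.2 (.inl hy)), rfl⟩
        · exact hP p hp
      · rw [List.length_cons, Multiset.replicate_succ, Multiset.cons_add, ← hsum, List.map_cons,
          List.sum_cons, ← Multiset.singleton_add]
        abel
      · rw [List.map_cons, List.sum_cons]; dsimp only; abel

/-- Derivations rewriting all the letters of `S` can be reordered so as to have index at most
`k`. -/
def HasIndex (R : V → M → Multiset V → Prop) (S : Finset V) (k : ℕ) : Prop :=
  ∀ α β m, Der R S α β m → α.card ≤ 2 → (∀ y ∈ β, y ∉ S) → BDer R S k α β m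

section Step

variable {S : Finset V} {X : V} {k : ℕ}

theorem IsPiece.bDer (hR : ∀ X u γ, R X u γ → γ.card ≤ 2) (hX : X ∉ S) (hk : HasIndex R S k)
    {p : Multiset V × M} (hp : IsPiece R S X p) (h0 : p.1.count X = 0) :
    BDer R (insert X S) (k + 2) {X} p.1 p.2 ∧ index (insert X S) p.1 = 0 := by
  obtain ⟨u, γ, m, hRX, hD, hS, e⟩ := hp
  have h := ((hk _ _ _ hD (hR _ _ _ hRX) hS).insert_letter hX).mono (l := k + 2) (by omega)
  refine ⟨e ▸ (BDer.single hRX (Finset.mem_insert_self _ _) (by omega) ?_).trans h, ?_⟩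
  · have := index_le_card (insert X S) γ
    have := hR _ _ _ hRX
    omega
  · rw [index_insert hX, h0, index_eq_zero.2 hS]

/-- Reassembling pieces into a derivation of small index: the last occurrence of `X` in a piece
is rewritten by the next nonterminal piece, the other ones by terminal pieces. -/
theorem BDer.assemble (hR : ∀ X u γ, R X u γ → γ.card ≤ 2) (hX : X ∉ S) (hk : HasIndex R S k)
    (N : List (Multiset V × M)) (hN : ∀ p ∈ N, IsPiece R S X p ∧ p.1.count X ≠ 0)
    {α δ ζ : Multiset V} {m : M} (h : BDer R S k α δ m) (hα : α.card ≤ 2) (hδ : ∀ y ∈ δ, y ∉ S)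
    (hδX : δ.count X ≠ 0) (T : List (Multiset V × M))
    (hT : ∀ p ∈ T, IsPiece R S X p ∧ p.1.count X = 0)
    (hζ : δ + (N.map Prod.fst).sum + (T.map Prod.fst).sum
      = Multiset.replicate (N.length + T.length) X + ζ) (hζX : ζ.count X = 0) :
    BDer R (insert X S) (2 * k + 5) α ζ (m + (N.map Prod.snd).sum + (T.map Prod.snd).sum) := by
  have hTcount : ∀ T : List (Multiset V × M), (∀ p ∈ T, IsPiece R S X p ∧ p.1.count X = 0) →
      index (insert X S) (T.map Prod.fst).sum = 0 := by
    intro T hT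
    induction T with
    | nil => simp [index]
    | cons t T ih =>
      rw [List.map_cons, List.sum_cons, index_add, ih (fun t ht => hT t (by simp [ht])),
        ((hT t (by simp)).1.bDer hR hX hk (hT t (by simp)).2).2]
  have hTX : ∀ T : List (Multiset V × M), (∀ p ∈ T, IsPiece R S X p ∧ p.1.count X = 0) →
      (T.map Prod.fst).sum.count X = 0 := by
    intro T hT
    have := hTcount T hT
    rw [index_insert hX] at this
    omega
  induction N generalizing α δ ζ m T with
  | nil =>
    simp only [List.map_nil, List.sum_nil, add_zero, List.length_nil, zero_add] at hζ ⊢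
    have hc := congrArg (Multiset.count X) hζ
    rw [Multiset.count_add, Multiset.count_add, hTX T hT, Multiset.count_replicate_self, hζX]
      at hc
    obtain ⟨δ', rfl⟩ : ∃ δ', δ = Multiset.replicate T.length X + δ' :=
      Multiset.le_iff_exists_add.1 (Multiset.le_count_iff_replicate_le.1 (by omega))
    rw [Multiset.count_add, Multiset.count_replicate_self] at hc
    rw [add_assoc, add_right_inj] at hζ
    rw [← hζ]
    exact (BDer.rewrite_letter (c := 0) (l := k + 2) hR hX h hα T
      (fun t ht => (hT t ht).1.bDer hR hX hk (hT t ht).2) δ' rfl (by omega)).mono (by omega)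
  | cons p N ih =>
    obtain ⟨⟨u, γ, m', hRX, hD, hpS, hpm⟩, hpX⟩ := hN p (by simp)
    have hNX : ∀ N : List (Multiset V × M), (∀ p ∈ N, IsPiece R S X p ∧ p.1.count X ≠ 0) →
        N.length ≤ (N.map Prod.fst).sum.count X := by
      intro N hN
      induction N with
      | nil => simp
      | cons t N ih =>
        have h1 := ih (fun t ht => hN t (by simp [ht]))
        have h2 := (hN t (by simp)).2
        rw [List.map_cons, List.sum_cons, Multiset.count_add, List.length_cons]
        omega
    have hN' : ∀ p ∈ N, IsPiece R S X p ∧ p.1.count X ≠ 0 := fun p hp => hN p (by simp [hp])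
    have hc := congrArg (Multiset.count X) hζ
    have := hNX N hN'
    rw [List.map_cons, List.sum_cons, List.length_cons, Multiset.count_add, Multiset.count_add,
      Multiset.count_add, Multiset.count_add, hTX T hT, Multiset.count_replicate_self, hζX] at hc
    set j := δ.count X - 1 with hj
    obtain ⟨δ', hδ'⟩ : ∃ δ', δ = Multiset.replicate (j + 1) X + δ' :=
      Multiset.le_iff_exists_add.1 (Multiset.le_count_iff_replicate_le.1 (by omega))
    have hδ'' : δ = Multiset.replicate j X + (X ::ₘ δ') := by
      rw [hδ', Multiset.replicate_succ, Multiset.cons_add, Multiset.add_cons]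
    have hcδ := congrArg (Multiset.count X) hδ'
    rw [Multiset.count_add, Multiset.count_replicate_self] at hcδ
    have hlen : (T.take j).length = j := by simp; omega
    have hlen' : (T.drop j).length = T.length - j := by simp
    have hT₁ : ∀ p ∈ T.take j, IsPiece R S X p ∧ p.1.count X = 0 :=
      fun p hp => hT p (List.mem_of_mem_take hp)
    have hT₂ : ∀ p ∈ T.drop j, IsPiece R S X p ∧ p.1.count X = 0 :=
      fun p hp => hT p (List.mem_of_mem_drop hp)
    have e₁ : (T.map Prod.fst).sum
        = ((T.take j).map Prod.fst).sum + ((T.drop j).map Prod.fst).sum := by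
      rw [← List.sum_append, ← List.map_append, List.take_append_drop]
    have e₂ : (T.map Prod.snd).sum
        = ((T.take j).map Prod.snd).sum + ((T.drop j).map Prod.snd).sum := by
      rw [← List.sum_append, ← List.map_append, List.take_append_drop]
    set ρ := δ' + ((T.take j).map Prod.fst).sum with hρ
    have hρ0 : index (insert X S) ρ = 0 := by
      rw [hρ, index_add, hTcount _ hT₁, index_insert hX, index_eq_zero.2 fun y hy => hδ y ?_]
      · omega
      · rw [hδ']; exact Multiset.mem_add.2 (.inr hy)
    have h₁ := BDer.rewrite_letter (c := 1) (l := k + 2) hR hX h hα (T.take j)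
      (fun t ht => (hT₁ t ht).1.bDer hR hX hk (hT₁ t ht).2) (X ::ₘ δ') (by rw [hlen, hδ''])
      (by rw [Multiset.count_cons_self]; omega)
    rw [Multiset.cons_add, ← hρ] at h₁
    have hγ := hR _ _ _ hRX
    have h₂ := (h₁.mono (l := 2 * k + 5) (by omega)).tail hRX (Finset.mem_insert_self _ _)
      (by rw [index_add, hρ0]; have := index_le_card (insert X S) γ; omega)
    have key : p.1 + (N.map Prod.fst).sum + ((T.drop j).map Prod.fst).sum + ρ
        = Multiset.replicate (N.length + (T.drop j).length) X + ζ := by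
      apply add_left_cancel (a := Multiset.replicate (j + 1) X)
      rw [← add_assoc (Multiset.replicate (j + 1) X) (Multiset.replicate _ _),
        ← Multiset.replicate_add]
      have : j + 1 + (N.length + (T.drop j).length) = (p :: N).length + T.length := by
        rw [List.length_cons]; omega
      rw [this, ← hζ, hδ', hρ, e₁, List.map_cons, List.sum_cons]
      abel
    have hρζ : ρ ≤ ζ := by
      rw [Multiset.le_iff_count]
      intro a
      have hka := congrArg (Multiset.count a) key
      rw [Multiset.count_add, Multiset.count_add (s := Multiset.replicate _ _)] at hka
      by_cases ha : a = X
      · subst ha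
        rw [index_insert hX] at hρ0
        omega
      · rw [Multiset.count_replicate, if_neg (Ne.symm ha)] at hka
        omega
    obtain ⟨ζ', rfl⟩ := Multiset.le_iff_exists_add.1 hρζ
    have h₃ := ih hN' (hk _ _ _ hD hγ hpS) hγ hpS hpX (T.drop j) hT₂ (ζ := ζ')
      (by
        apply add_right_cancel (b := ρ)
        rw [key]
        abel)
      (by rw [Multiset.count_add] at hζX; omega)
    have h₄ := h₂.trans (h₃.add_right (r := 0) hρ0.le)
    rw [e₂, List.map_cons, List.sum_cons, hpm]
    convert h₄ using 1 <;> abel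

theorem HasIndex.insert (hR : ∀ X u γ, R X u γ → γ.card ≤ 2) (hX : X ∉ S)
    (hk : HasIndex R S k) : HasIndex R (insert X S) (2 * k + 5) := by
  intro α β m h hα hβ
  obtain ⟨δ, m₀, P, hD, hδ, hP, h0, hsum, rfl⟩ := h.exists_pieces hβ
  have hB := hk _ _ _ hD hα hδ
  by_cases hδX : δ.count X = 0
  · obtain rfl := h0 hδX
    obtain rfl : δ = β := by simpa using hsum
    simpa using (hB.insert_letter hX).mono (by omega)
  · obtain ⟨N, T, hN, hT, hlen, h₁, h₂⟩ : ∃ N T : List (Multiset V × M),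
        (∀ p ∈ N, IsPiece R S X p ∧ p.1.count X ≠ 0) ∧
        (∀ p ∈ T, IsPiece R S X p ∧ p.1.count X = 0) ∧ P.length = N.length + T.length ∧
        (P.map Prod.fst).sum = (N.map Prod.fst).sum + (T.map Prod.fst).sum ∧
        (P.map Prod.snd).sum = (N.map Prod.snd).sum + (T.map Prod.snd).sum := by
      clear h0 hsum h
      induction P with
      | nil => exact ⟨[], [], by simp⟩
      | cons p P ih =>
        obtain ⟨N, T, hN, hT, hlen, h₁, h₂⟩ := ih (fun p hp => hP p (by simp [hp]))
        by_cases hp : p.1.count X = 0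
        · refine ⟨N, p :: T, hN, ?_, by simp [hlen]; omega, ?_, ?_⟩
          · intro q hq
            rcases List.mem_cons.1 hq with rfl | hq
            exacts [⟨hP _ (by simp), hp⟩, hT q hq]
          · simp only [List.map_cons, List.sum_cons, h₁]; abel
          · simp only [List.map_cons, List.sum_cons, h₂]; abel
        · refine ⟨p :: N, T, ?_, hT, by simp [hlen]; omega, ?_, ?_⟩
          · intro q hq
            rcases List.mem_cons.1 hq with rfl | hq
            exacts [⟨hP _ (by simp), hp⟩, hN q hq]
          · simp only [List.map_cons, List.sum_cons, h₁]; abel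
          · simp only [List.map_cons, List.sum_cons, h₂]; abel
    rw [h₂, ← add_assoc]
    rw [h₁, hlen, ← add_assoc] at hsum
    exact hB.assemble hR hX hk N hN hα hδ hδX T hT hsum
      (Multiset.count_eq_zero.2 fun h => hβ _ h (Finset.mem_insert_self _ _))

end Step

/-- A bound on the index of derivations rewriting `n` letters. -/
def indexBound (n : ℕ) : ℕ := Nat.rec 0 (fun _ k => 2 * k + 5) n

theorem indexBound_mono : Monotone indexBound :=
  monotone_nat_of_le_succ fun n => by
    change indexBound n ≤ 2 * indexBound n + 5
    omega

theorem hasIndex_indexBound (hR : ∀ X u γ, R X u γ → γ.card ≤ 2) (S : Finset V) :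
    HasIndex R S (indexBound S.card) := by
  induction S using Finset.induction_on with
  | empty =>
    intro α β m h _ _
    cases h with
    | refl => exact .refl _ (by simp [index])
    | head _ h => simp at h
  | insert X S hX ih =>
    rw [Finset.card_insert_of_notMem hX]
    exact ih.insert hR hX

end Grammar

section Construction

/-- `(x, 0, z)` stands for the runs from `x` to `z` that start and end with an empty stack, and
`(x, γ + 1, z)` for those that start with stack `γ` and end with an empty stack. -/
abbrev Item : Type := ℕ × ℕ × ℕ

/-- The second component of the items starting with the stack read by a pop edge. -/
def tag (l : PLabel) : ℕ := l.elim 0 fun a => a.2 + 1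

section Lists

variable {N : Type*}

def controls (q₀ : ℕ) (E : List (ℕ × PLabel × N × ℕ)) : List ℕ :=
  q₀ :: E.flatMap fun e => [e.1, e.2.2.2]

def items (q₀ : ℕ) (E : List (ℕ × PLabel × N × ℕ)) : List Item :=
  (controls q₀ E).flatMap fun x => (0 :: E.map fun e => tag e.2.1).flatMap fun o =>
    (controls q₀ E).map fun z => (x, o, z)

def edgeRules (Q : List ℕ) (e : ℕ × PLabel × N × ℕ) (z : ℕ) : List (Item × N × List Item) :=
  match e.2.1 with
  | none => [((e.1, 0, z), e.2.2.1, [(e.2.2.2, 0, z)])]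
  | some (false, g) =>
    Q.map fun y => ((e.1, 0, z), e.2.2.1, [(e.2.2.2, 0, y), (y, g + 1, z)])
  | some (true, g) => [((e.1, g + 1, z), e.2.2.1, [(e.2.2.2, 0, z)])]

/-- The rules of the commutative grammar generating the outputs of the runs that an item
stands for. -/
def rules (zero : N) (q₀ : ℕ) (E : List (ℕ × PLabel × N × ℕ)) : List (Item × N × List Item) :=
  ((controls q₀ E).map fun x => ((x, 0, x), zero, [])) ++
    E.flatMap fun e => (controls q₀ E).flatMap fun z => edgeRules (controls q₀ E) e z

/-- The words of length at most `k` over the alphabet `V`. -/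
def wordsUpTo (V : List Item) (k : ℕ) : List (List Item) :=
  Nat.rec [[]] (fun _ L => [] :: V.flatMap fun x => L.map fun l => x :: l) k

/-- The code of the automaton state with control `p` and pending items `l`. -/
def code (p : ℕ) (l : List Item) : ℕ := Encodable.encode (p, l)

def controlEdges (e : ℕ × PLabel × N × ℕ) : List (ℕ × (List ℕ × N) × ℕ) :=
  match e.2.1 with
  | none => [(code e.1 [], ([], e.2.2.1), code e.2.2.2 [])]
  | some (false, g) => [(code e.1 [], ([g], e.2.2.1), code e.2.2.2 [])]
  | some (true, _) => []

def jumpEdges (zero : N) (Q : List ℕ) : List (ℕ × (List ℕ × N) × ℕ) :=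
  Q.flatMap fun a => Q.map fun b => (code a [], ([], zero), code b [(a, 0, b)])

def pendingEdges (zero : N) (V : List Item) (Rs : List (Item × N × List Item)) (p : ℕ)
    (l : List Item) : List (ℕ × (List ℕ × N) × ℕ) :=
  (Rs.map fun r => (code p (r.1 :: l), ([], r.2.1), code p (r.2.2 ++ l))) ++
    V.map fun x => (code p (x :: l), ([], zero), code p (l ++ [x]))

/-- The edges of the automaton: it simulates the steps that are never undone, guesses the
balanced parts of the run, and checks its guesses by a derivation of bounded index. -/
def autEdges (zero : N) (q₀ : ℕ) (E : List (ℕ × PLabel × N × ℕ)) :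
    List (ℕ × (List ℕ × N) × ℕ) :=
  E.flatMap controlEdges ++ (jumpEdges zero (controls q₀ E) ++
    (controls q₀ E).flatMap fun p =>
      (wordsUpTo (items q₀ E) (indexBound (items q₀ E).length)).flatMap fun l =>
        pendingEdges zero (items q₀ E) (rules zero q₀ E) p l)

def autStates (zero : N) (q₀ q : ℕ) (E : List (ℕ × PLabel × N × ℕ)) : List ℕ :=
  code q₀ [] :: code q [] :: (autEdges zero q₀ E).flatMap fun e => [e.1, e.2.2]

end Lists

theorem code_inj {p p' : ℕ} {l l' : List Item} : code p l = code p' l' ↔ p = p' ∧ l = l' := by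
  simp [code, Encodable.encode_inj]

theorem mem_wordsUpTo {V : List Item} {k : ℕ} {l : List Item} :
    l ∈ wordsUpTo V k ↔ l.length ≤ k ∧ ∀ x ∈ l, x ∈ V := by
  induction k generalizing l with
  | zero =>
    change l ∈ [[]] ↔ _
    simp only [List.mem_singleton, Nat.le_zero, List.length_eq_zero_iff]
    constructor
    · rintro rfl; simp
    · exact fun h => h.1
  | succ k ih =>
    change l ∈ [] :: V.flatMap (fun x => (wordsUpTo V k).map fun l => x :: l) ↔ _
    cases l with
    | nil => simp
    | cons x l =>
      simp only [List.mem_cons, reduceCtorEq, List.mem_flatMap, List.mem_map, List.cons.injEq,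
        false_or, List.length_cons, Nat.add_le_add_iff_right, forall_eq_or_imp, ih]
      constructor
      · rintro ⟨_, hx, _, ⟨h, h'⟩, rfl, rfl⟩; exact ⟨h, hx, h'⟩
      · rintro ⟨h, hx, h'⟩; exact ⟨x, hx, l, ⟨h, h'⟩, rfl, rfl⟩

variable {q₀ : ℕ} {E : List (ℕ × PLabel × Vec × ℕ)}

theorem source_mem_controls {e : ℕ × PLabel × Vec × ℕ} (he : e ∈ E) : e.1 ∈ controls q₀ E :=
  List.mem_cons_of_mem _ (List.mem_flatMap.2 ⟨e, he, by simp⟩)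

theorem target_mem_controls {e : ℕ × PLabel × Vec × ℕ} (he : e ∈ E) :
    e.2.2.2 ∈ controls q₀ E :=
  List.mem_cons_of_mem _ (List.mem_flatMap.2 ⟨e, he, by simp⟩)

theorem mem_items {x o z : ℕ} :
    (x, o, z) ∈ items q₀ E ↔ x ∈ controls q₀ E ∧ (o = 0 ∨ ∃ e ∈ E, tag e.2.1 = o) ∧
      z ∈ controls q₀ E := by
  simp only [items, List.mem_flatMap, List.mem_map, List.mem_cons, Prod.mk.injEq]
  constructor
  · rintro ⟨_, hx, _, ho, _, hz, rfl, rfl, rfl⟩; exact ⟨hx, ho, hz⟩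
  · rintro ⟨hx, ho, hz⟩; exact ⟨x, hx, o, ho, z, hz, rfl, rfl, rfl⟩

/-- The outputs of the runs that an item stands for. -/
inductive Bal (q₀ : ℕ) (E : List (ℕ × PLabel × Vec × ℕ)) : ℕ → ℕ → ℕ → Vec → Prop
  | nil {x : ℕ} : x ∈ controls q₀ E → Bal q₀ E x 0 x 0
  | eps {a b z : ℕ} {n v : Vec} : (a, none, n, b) ∈ E → z ∈ controls q₀ E →
      Bal q₀ E b 0 z v → Bal q₀ E a 0 z (n + v)
  | push {a b y z g : ℕ} {n v v' : Vec} : (a, some (false, g), n, b) ∈ E → y ∈ controls q₀ E →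
      z ∈ controls q₀ E → Bal q₀ E b 0 y v → Bal q₀ E y (g + 1) z v' →
      Bal q₀ E a 0 z (n + (v + v'))
  | pop {a b z g : ℕ} {n v : Vec} : (a, some (true, g), n, b) ∈ E → z ∈ controls q₀ E →
      Bal q₀ E b 0 z v → Bal q₀ E a (g + 1) z (n + v)

/-- One rule application of the grammar, seen as a relation. -/
def RuleRel (q₀ : ℕ) (E : List (ℕ × PLabel × Vec × ℕ)) (X : Item) (u : Vec)
    (γ : Multiset Item) : Prop :=
  ∃ l : List Item, (X, u, l) ∈ rules 0 q₀ E ∧ γ = l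

theorem mem_rules {r : Item × Vec × List Item} :
    r ∈ rules 0 q₀ E ↔ (∃ x ∈ controls q₀ E, r = ((x, 0, x), 0, [])) ∨
      (∃ a n b, (a, none, n, b) ∈ E ∧ ∃ z ∈ controls q₀ E, r = ((a, 0, z), n, [(b, 0, z)])) ∨
      (∃ a g n b, (a, some (false, g), n, b) ∈ E ∧ ∃ z ∈ controls q₀ E, ∃ y ∈ controls q₀ E,
        r = ((a, 0, z), n, [(b, 0, y), (y, g + 1, z)])) ∨
      (∃ a g n b, (a, some (true, g), n, b) ∈ E ∧ ∃ z ∈ controls q₀ E,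
        r = ((a, g + 1, z), n, [(b, 0, z)])) := by
  rw [rules, List.mem_append, List.mem_map, List.mem_flatMap]
  refine or_congr (by simp only [eq_comm]) ?_
  constructor
  · rintro ⟨⟨a, l, n, b⟩, he, hr⟩
    obtain ⟨z, hz, hr⟩ := List.mem_flatMap.1 hr
    rcases l with _ | ⟨_ | _, g⟩
    · exact .inl ⟨a, n, b, he, z, hz, by simpa [edgeRules] using hr⟩
    · obtain ⟨y, hy, rfl⟩ := List.mem_map.1 hr
      exact .inr (.inl ⟨a, g, n, b, he, z, hz, y, hy, rfl⟩)
    · exact .inr (.inr ⟨a, g, n, b, he, z, hz, by simpa [edgeRules] using hr⟩)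
  · rintro (⟨a, n, b, he, z, hz, rfl⟩ | ⟨a, g, n, b, he, z, hz, y, hy, rfl⟩ |
      ⟨a, g, n, b, he, z, hz, rfl⟩)
    · exact ⟨_, he, List.mem_flatMap.2 ⟨z, hz, by simp [edgeRules]⟩⟩
    · exact ⟨_, he, List.mem_flatMap.2 ⟨z, hz, List.mem_map.2 ⟨y, hy, rfl⟩⟩⟩
    · exact ⟨_, he, List.mem_flatMap.2 ⟨z, hz, by simp [edgeRules]⟩⟩

theorem RuleRel.card_le {X : Item} {u : Vec} {γ : Multiset Item} (h : RuleRel q₀ E X u γ) :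
    γ.card ≤ 2 := by
  obtain ⟨l, h, rfl⟩ := h
  rcases mem_rules.1 h with ⟨_, _, h⟩ | ⟨_, _, _, _, _, _, h⟩ | ⟨_, _, _, _, _, _, _, _, _, h⟩ |
    ⟨_, _, _, _, _, _, _, h⟩ <;> simp only [Prod.mk.injEq] at h <;> simp [h.2.2]

theorem RuleRel.mem_items {X : Item} {u : Vec} {γ : Multiset Item} (h : RuleRel q₀ E X u γ) :
    X ∈ items q₀ E ∧ ∀ y ∈ γ, y ∈ items q₀ E := by
  obtain ⟨l, h, rfl⟩ := h
  rcases mem_rules.1 h with ⟨x, hx, h⟩ | ⟨a, n, b, he, z, hz, h⟩ |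
      ⟨a, g, n, b, he, z, hz, y, hy, h⟩ | ⟨a, g, n, b, he, z, hz, h⟩ <;>
    simp only [Prod.mk.injEq] at h <;> obtain ⟨rfl, rfl, rfl⟩ := h
  · simp [CBL.mem_items, hx]
  all_goals
    have h₁ := source_mem_controls (q₀ := q₀) he
    have h₂ := target_mem_controls (q₀ := q₀) he
    simp only at h₁ h₂
    simp [CBL.mem_items, h₁, h₂, hz]
  · exact ⟨hy, _, _, ⟨_, _, he⟩, rfl⟩
  · exact ⟨_, _, ⟨_, _, he⟩, rfl⟩

theorem Bal.target_mem {x o z : ℕ} {v : Vec} (h : Bal q₀ E x o z v) : z ∈ controls q₀ E := by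
  cases h <;> assumption

theorem Bal.trans {x o y z : ℕ} {v v' : Vec} (h : Bal q₀ E x o y v) (h' : Bal q₀ E y 0 z v') :
    Bal q₀ E x o z (v + v') := by
  have hz := h'.target_mem
  induction h with
  | nil => rwa [zero_add]
  | eps he _ _ ih => rw [add_assoc]; exact .eps he hz (ih h')
  | push he hy _ h₁ _ _ ih => rw [add_assoc, add_assoc]; exact .push he hy hz h₁ (ih h')
  | pop he _ _ ih => rw [add_assoc]; exact .pop he hz (ih h')

theorem Bal.der {x o z : ℕ} {v : Vec} (h : Bal q₀ E x o z v) :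
    Der (RuleRel q₀ E) (items q₀ E).toFinset {(x, o, z)} 0 v := by
  have key : ∀ {X : Item} {u v : Vec} {l : List Item}, (X, u, l) ∈ rules 0 q₀ E →
      Der (RuleRel q₀ E) (items q₀ E).toFinset l 0 v →
      Der (RuleRel q₀ E) (items q₀ E).toFinset {X} 0 (u + v) := by
    intro X u v l hr h
    have hR : RuleRel q₀ E X u l := ⟨l, hr, rfl⟩
    exact .head hR (List.mem_toFinset.2 hR.mem_items.1) (by rwa [add_zero])
  induction h with
  | @nil x hx =>
    have := key (v := 0) (mem_rules.2 (.inl ⟨x, hx, rfl⟩)) (.refl _)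
    rwa [add_zero] at this
  | eps he hz _ ih => exact key (mem_rules.2 (.inr (.inl ⟨_, _, _, he, _, hz, rfl⟩))) ih
  | push he hy hz _ _ ih ih' =>
    refine key (mem_rules.2 (.inr (.inr (.inl ⟨_, _, _, _, he, _, hz, _, hy, rfl⟩)))) ?_
    have := ih.add ih'
    rwa [add_zero] at this
  | pop he hz _ ih =>
    exact key (mem_rules.2 (.inr (.inr (.inr ⟨_, _, _, _, he, _, hz, rfl⟩)))) ih

/-- The outputs of the families of runs that a multiset of items stands for. -/
def MBal (q₀ : ℕ) (E : List (ℕ × PLabel × Vec × ℕ)) (α : Multiset Item) (v : Vec) : Prop :=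
  ∃ s : Multiset (Item × Vec), s.map Prod.fst = α ∧
    (∀ x ∈ s, Bal q₀ E x.1.1 x.1.2.1 x.1.2.2 x.2) ∧ (s.map Prod.snd).sum = v

theorem MBal.zero : MBal q₀ E 0 0 := ⟨0, by simp⟩

theorem MBal.cons_iff {x o z : ℕ} {α : Multiset Item} {v : Vec} :
    MBal q₀ E ((x, o, z) ::ₘ α) v ↔
      ∃ v₁ v₂, Bal q₀ E x o z v₁ ∧ MBal q₀ E α v₂ ∧ v = v₁ + v₂ := by
  constructor
  · rintro ⟨s, hs, hB, rfl⟩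
    obtain ⟨⟨a, v₁⟩, ha, rfl, hs⟩ := Multiset.map_eq_cons _ _ _ _ |>.2 hs
    obtain ⟨s, rfl⟩ := Multiset.exists_cons_of_mem ha
    rw [Multiset.erase_cons_head] at hs
    exact ⟨v₁, _, hB _ ha, ⟨s, hs, fun y hy => hB y (Multiset.mem_cons_of_mem hy), rfl⟩, by simp⟩
  · rintro ⟨v₁, v₂, h, ⟨s, rfl, hB, rfl⟩, rfl⟩
    refine ⟨((x, o, z), v₁) ::ₘ s, by simp, ?_, by simp⟩
    intro y hy
    rcases Multiset.mem_cons.1 hy with rfl | hy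
    exacts [h, hB y hy]

theorem MBal.of_rule {X : Item} {u v : Vec} {l t : List Item} (hr : (X, u, l) ∈ rules 0 q₀ E)
    (h : MBal q₀ E (l ++ t : List Item) v) : MBal q₀ E (X :: t : List Item) (u + v) := by
  rcases mem_rules.1 hr with ⟨x, hx, hr⟩ | ⟨a, n, b, he, z, hz, hr⟩ |
      ⟨a, g, n, b, he, z, hz, y, hy, hr⟩ | ⟨a, g, n, b, he, z, hz, hr⟩ <;>
    simp only [Prod.mk.injEq] at hr <;> obtain ⟨rfl, rfl, rfl⟩ := hr <;>
    simp only [List.cons_append, List.nil_append, ← Multiset.cons_coe] at h ⊢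
  · exact cons_iff.2 ⟨0, v, .nil hx, h, rfl⟩
  · obtain ⟨v₁, v₂, h₁, h₂, rfl⟩ := cons_iff.1 h
    exact cons_iff.2 ⟨_, _, .eps he hz h₁, h₂, (add_assoc _ _ _).symm⟩
  · obtain ⟨v₁, v₂, h₁, h₂, rfl⟩ := cons_iff.1 h
    obtain ⟨v₃, v₄, h₃, h₄, rfl⟩ := cons_iff.1 h₂
    exact cons_iff.2 ⟨_, _, .push he hy hz h₁ h₃, h₄, by simp only [add_assoc]⟩
  · obtain ⟨v₁, v₂, h₁, h₂, rfl⟩ := cons_iff.1 h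
    exact cons_iff.2 ⟨_, _, .pop he hz h₁, h₂, (add_assoc _ _ _).symm⟩

/-- The automaton recognizing `I_{A,q}`, for the pushdown automaton with initial state `q₀` and
edges `E`. -/
def aut (q₀ q : ℕ) (E : List (ℕ × PLabel × Vec × ℕ)) : RatAut where
  states := (autStates 0 q₀ q E).toFinset
  edges := (autEdges 0 q₀ E).toFinset
  q0 := code q₀ []
  final := {code q []}

theorem mem_autEdges {s s' : ℕ} {w : List ℕ} {n : Vec} : (s, (w, n), s') ∈ autEdges 0 q₀ E ↔
    (∃ a b, (a, none, n, b) ∈ E ∧ s = code a [] ∧ w = [] ∧ s' = code b []) ∨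
    (∃ a g b, (a, some (false, g), n, b) ∈ E ∧ s = code a [] ∧ w = [g] ∧ s' = code b []) ∨
    (∃ a ∈ controls q₀ E, ∃ b ∈ controls q₀ E,
      s = code a [] ∧ w = [] ∧ n = 0 ∧ s' = code b [(a, 0, b)]) ∨
    (∃ p ∈ controls q₀ E, ∃ t ∈ wordsUpTo (items q₀ E) (indexBound (items q₀ E).length),
      ∃ X l, (X, n, l) ∈ rules 0 q₀ E ∧ s = code p (X :: t) ∧ w = [] ∧ s' = code p (l ++ t)) ∨
    (∃ p ∈ controls q₀ E, ∃ t ∈ wordsUpTo (items q₀ E) (indexBound (items q₀ E).length),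
      ∃ X ∈ items q₀ E, s = code p (X :: t) ∧ w = [] ∧ n = 0 ∧ s' = code p (t ++ [X])) := by
  rw [autEdges, List.mem_append, List.mem_append]
  refine (or_congr ?_ (or_congr ?_ ?_)).trans or_assoc
  · rw [List.mem_flatMap]
    constructor
    · rintro ⟨⟨a, _ | ⟨_ | _, g⟩, n, b⟩, he, h⟩ <;> simp [controlEdges] at h <;>
        obtain ⟨rfl, ⟨rfl, rfl⟩, rfl⟩ := h
      · exact .inl ⟨a, b, he, rfl, rfl, rfl⟩
      · exact .inr ⟨a, g, b, he, rfl, rfl, rfl⟩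
    · rintro (⟨a, b, he, rfl, rfl, rfl⟩ | ⟨a, g, b, he, rfl, rfl, rfl⟩) <;>
        exact ⟨_, he, by simp [controlEdges]⟩
  · simp only [jumpEdges, List.mem_flatMap, List.mem_map, Prod.mk.injEq]
    constructor
    · rintro ⟨a, ha, b, hb, rfl, ⟨rfl, rfl⟩, rfl⟩; exact ⟨a, ha, b, hb, rfl, rfl, rfl, rfl⟩
    · rintro ⟨a, ha, b, hb, rfl, rfl, rfl, rfl⟩; exact ⟨a, ha, b, hb, rfl, ⟨rfl, rfl⟩, rfl⟩
  · simp only [pendingEdges, List.mem_flatMap, List.mem_append, List.mem_map, Prod.mk.injEq]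
    constructor
    · rintro ⟨p, hp, t, ht, ⟨⟨X, n, l⟩, hr, rfl, ⟨rfl, rfl⟩, rfl⟩ |
        ⟨X, hX, rfl, ⟨rfl, rfl⟩, rfl⟩⟩
      · exact .inl ⟨p, hp, t, ht, X, l, hr, rfl, rfl, rfl⟩
      · exact .inr ⟨p, hp, t, ht, X, hX, rfl, rfl, rfl, rfl⟩
    · rintro (⟨p, hp, t, ht, X, l, hr, rfl, rfl, rfl⟩ | ⟨p, hp, t, ht, X, hX, rfl, rfl, rfl, rfl⟩)
      · exact ⟨p, hp, t, ht, .inl ⟨_, hr, rfl, ⟨rfl, rfl⟩, rfl⟩⟩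
      · exact ⟨p, hp, t, ht, .inr ⟨_, hX, rfl, ⟨rfl, rfl⟩, rfl⟩⟩

theorem rStep_aut {q s s' : ℕ} {w u : List ℕ} {m n : Vec}
    (h : (s, (u, n), s') ∈ autEdges 0 q₀ E) :
    RStep (aut q₀ q E) (s, w, m) (s', w ++ u, m + n) :=
  ⟨_, List.mem_toFinset.2 h, rfl, rfl, rfl, rfl⟩

theorem rStep_aut_nil {q s s' : ℕ} {w : List ℕ} {m n : Vec}
    (h : (s, ([], n), s') ∈ autEdges 0 q₀ E) :
    RStep (aut q₀ q E) (s, w, m) (s', w, m + n) := by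
  simpa using rStep_aut (w := w) (m := m) h

theorem BDer.mem_items {S : Finset Item} {k : ℕ} {α δ : Multiset Item} {m : Vec}
    (h : BDer (RuleRel q₀ E) S k α δ m) (hα : ∀ x ∈ α, x ∈ items q₀ E) :
    ∀ x ∈ δ, x ∈ items q₀ E := by
  induction h with
  | refl => exact hα
  | tail _ hR _ _ ih =>
    intro x hx
    rcases Multiset.mem_add.1 hx with hx | hx
    · exact hR.mem_items.2 x hx
    · exact ih hα x (Multiset.mem_cons_of_mem hx)

section Simulation

variable {p q : ℕ} {w : List ℕ} {m : Vec}

theorem rotate_aut (hp : p ∈ controls q₀ E) (l₁ l₂ : List Item)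
    (h : ∀ x ∈ l₁ ++ l₂, x ∈ items q₀ E)
    (hlen : (l₁ ++ l₂).length ≤ indexBound (items q₀ E).length) :
    Relation.ReflTransGen (RStep (aut q₀ q E)) (code p (l₁ ++ l₂), w, m)
      (code p (l₂ ++ l₁), w, m) := by
  induction l₁ generalizing l₂ with
  | nil => rw [List.nil_append, List.append_nil]
  | cons x l₁ ih =>
    have e : l₂ ++ x :: l₁ = (l₂ ++ [x]) ++ l₁ := by simp
    have h₁ : (code p (x :: (l₁ ++ l₂)), (([] : List ℕ), (0 : Vec)), code p (l₁ ++ l₂ ++ [x])) ∈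
        autEdges 0 q₀ E := by
      refine mem_autEdges.2 (.inr (.inr (.inr (.inr ⟨p, hp, l₁ ++ l₂, ?_, x, h x (by simp),
        rfl, rfl, rfl, rfl⟩))))
      refine mem_wordsUpTo.2 ⟨?_, fun y hy => h y (by simp_all)⟩
      simp at hlen ⊢; omega
    have h₂ := rStep_aut_nil (q := q) (w := w) (m := m) h₁
    rw [add_zero] at h₂
    rw [e, List.cons_append]
    refine .head h₂ ?_
    rw [List.append_assoc]
    refine ih (l₂ ++ [x]) (fun y hy => h y ?_) ?_
    · simp at hy ⊢; tauto
    · simp at hlen ⊢; omega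

theorem index_eq_card {S : Finset Item} {α : Multiset Item} (h : ∀ x ∈ α, x ∈ S) :
    index S α = α.card := Multiset.countP_eq_card.2 h

theorem derive_aut (hp : p ∈ controls q₀ E) {α δ : Multiset Item} {v : Vec}
    (h : BDer (RuleRel q₀ E) (items q₀ E).toFinset (indexBound (items q₀ E).length) α δ v)
    (hα : ∀ x ∈ α, x ∈ items q₀ E) (l : List Item) (hl : (l : Multiset Item) = α) :
    ∃ l' : List Item, (l' : Multiset Item) = δ ∧ l'.length ≤ indexBound (items q₀ E).length ∧
      Relation.ReflTransGen (RStep (aut q₀ q E)) (code p l, w, m) (code p l', w, m + v) := by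
  induction h with
  | refl α hk =>
    subst hl
    refine ⟨l, rfl, ?_, by rw [add_zero]⟩
    rwa [index_eq_card (by simpa using hα), Multiset.coe_card] at hk
  | @tail X u v γ α δ hB hR hX hk ih =>
    obtain ⟨l', hl', hlen, hrun⟩ := ih hα hl
    have hδ := hB.mem_items hα
    have hXl : X ∈ l' := Multiset.mem_coe.1 (hl' ▸ Multiset.mem_cons_self _ _)
    obtain ⟨l₁, l₂, rfl⟩ := List.append_of_mem hXl
    have hδ' : ((l₂ ++ l₁ : List Item) : Multiset Item) = δ := by
      rw [← Multiset.cons_inj_right X, ← hl', Multiset.cons_coe, Multiset.coe_eq_coe]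
      exact (List.perm_append_comm (l₁ := X :: l₂) (l₂ := l₁))
    have hrot := rotate_aut (q := q) (w := w) (m := m + v) hp l₁ (X :: l₂)
      (fun x hx => hδ x (by rw [← hl']; exact hx)) hlen
    obtain ⟨g, hg, rfl⟩ := hR
    have hR : RuleRel q₀ E X u g := ⟨g, hg, rfl⟩
    have hedge : (code p (X :: (l₂ ++ l₁)), (([] : List ℕ), u), code p (g ++ (l₂ ++ l₁))) ∈
        autEdges 0 q₀ E := by
      refine mem_autEdges.2 (.inr (.inr (.inr (.inl ⟨p, hp, l₂ ++ l₁, ?_, X, g, hg,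
        rfl, rfl, rfl⟩))))
      refine mem_wordsUpTo.2 ⟨by simp at hlen ⊢; omega, fun y hy => hδ y ?_⟩
      rw [← hδ']
      exact Multiset.mem_cons_of_mem hy
    refine ⟨g ++ (l₂ ++ l₁), by rw [← Multiset.coe_add, hδ'], ?_, ?_⟩
    · rw [← hδ', index_eq_card, Multiset.card_add, Multiset.coe_card, Multiset.coe_card] at hk
      · rwa [List.length_append]
      · intro x hx
        rw [List.mem_toFinset]
        rcases Multiset.mem_add.1 hx with hx | hx
        · exact hR.mem_items.2 x hx
        · exact hδ x (Multiset.mem_cons_of_mem (hδ' ▸ hx))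
    · rw [← add_assoc]
      exact (hrun.trans hrot).tail (rStep_aut_nil hedge)

theorem bal_aut {x z : ℕ} {v : Vec} (hx : x ∈ controls q₀ E) (h : Bal q₀ E x 0 z v) :
    Relation.ReflTransGen (RStep (aut q₀ q E)) (code x [], w, m) (code z [], w, m + v) := by
  have hz := h.target_mem
  have hmem : (x, 0, z) ∈ items q₀ E := mem_items.2 ⟨hx, .inl rfl, hz⟩
  have hB := (hasIndex_indexBound (fun _ _ _ => RuleRel.card_le) _ _ _ _ h.der (by simp)
    (by simp)).mono (indexBound_mono (List.toFinset_card_le (items q₀ E)))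
  obtain ⟨l', hl', -, hrun⟩ := derive_aut (q := q) (w := w) (m := m + 0) hz hB
    (by simpa using hmem) [(x, 0, z)] rfl
  obtain rfl := (Multiset.coe_eq_zero _).1 hl'
  refine .head (rStep_aut_nil (n := 0) (mem_autEdges.2 (.inr (.inr (.inl
    ⟨x, hx, z, hz, rfl, rfl, rfl, rfl⟩))))) ?_
  rwa [add_zero] at hrun ⊢

end Simulation

variable {A : PDAO} {q : ℕ} {w : List ℕ} {m : Vec}

/-- The runs of a pushdown automaton, decomposed into steps that are never undone and balanced
parts. -/
inductive Decomposed (q₀ : ℕ) (E : List (ℕ × PLabel × Vec × ℕ)) : ℕ → List ℕ → Vec → Prop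
  | start : Decomposed q₀ E q₀ [] 0
  | eps {a b : ℕ} {w : List ℕ} {m n : Vec} : Decomposed q₀ E a w m → (a, none, n, b) ∈ E →
      Decomposed q₀ E b w (m + n)
  | push {a b g : ℕ} {w : List ℕ} {m n : Vec} : Decomposed q₀ E a w m →
      (a, some (false, g), n, b) ∈ E → Decomposed q₀ E b (w ++ [g]) (m + n)
  | bal {a b : ℕ} {w : List ℕ} {m n : Vec} : Decomposed q₀ E a w m → Bal q₀ E a 0 b n →
      Decomposed q₀ E b w (m + n)

theorem Decomposed.mem_controls {p : ℕ} (h : Decomposed q₀ E p w m) : p ∈ controls q₀ E := by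
  cases h with
  | start => exact List.mem_cons_self
  | eps _ he => exact target_mem_controls he
  | push _ he => exact target_mem_controls he
  | bal _ hb => exact hb.target_mem

theorem Decomposed.exists_push {c g : ℕ} {w' : List ℕ} (h : Decomposed q₀ E c w' m)
    (hw : w' = w ++ [g]) : ∃ a b n m' v, Decomposed q₀ E a w m' ∧
      (a, some (false, g), n, b) ∈ E ∧ Bal q₀ E b 0 c v ∧ m = m' + (n + v) := by
  induction h with
  | start => simp at hw
  | @eps c d w' m n _ he ih =>
    obtain ⟨a, b, n', m', v, hD, he', hB, rfl⟩ := ih hw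
    have hd := target_mem_controls (q₀ := q₀) he
    refine ⟨a, b, n', m', v + (n + 0), hD, he', hB.trans (.eps he hd (.nil hd)), ?_⟩
    simp only [add_assoc, add_zero]
  | @push c d g' w' m n hD he _ =>
    obtain ⟨rfl, h⟩ := List.append_inj' hw rfl
    obtain rfl : g' = g := by simpa using h
    exact ⟨c, d, n, m, 0, hD, he, .nil (target_mem_controls (q₀ := q₀) he), by rw [add_zero]⟩
  | @bal c d w' m n _ hB' ih =>
    obtain ⟨a, b, n', m', v, hD, he', hB, rfl⟩ := ih hw
    exact ⟨a, b, n', m', v + n, hD, he', hB.trans hB', by simp only [add_assoc]⟩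

theorem Decomposed.of_reach (hE : ∀ e, e ∈ E ↔ e ∈ A.edges) {c : PConf}
    (h : PReach A (A.q0, [], 0) c) : Decomposed A.q0 E c.1 c.2.1 c.2.2 := by
  induction h with
  | refl => exact .start
  | @tail c d _ hstep ih =>
    obtain ⟨c₁, c₂, c₃⟩ := c
    obtain ⟨d₁, d₂, d₃⟩ := d
    obtain ⟨⟨a, l, n, b⟩, he, h₁, h₂, h₃, h₄⟩ := hstep
    rw [← hE] at he
    dsimp only at *
    subst h₁ h₂ h₃
    rcases l with _ | ⟨_ | _, g⟩ <;> dsimp only at h₄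
    · subst h₄; exact ih.eps he
    · subst h₄; exact ih.push he
    · obtain ⟨a, b, n', m', v, hD, he', hB, rfl⟩ := ih.exists_push h₄
      have hd := target_mem_controls (q₀ := A.q0) he
      have := hD.bal (.push he' (source_mem_controls (q₀ := A.q0) he) hd hB
        (.pop he hd (.nil hd)))
      simpa only [add_assoc, add_zero] using this

theorem Decomposed.run_aut {p : ℕ} (h : Decomposed q₀ E p w m) :
    Relation.ReflTransGen (RStep (aut q₀ q E)) (code q₀ [], [], 0) (code p [], w, m) := by
  induction h with
  | start => exact .refl
  | eps _ he ih =>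
    exact ih.tail (rStep_aut_nil (mem_autEdges.2 (.inl ⟨_, _, he, rfl, rfl, rfl⟩)))
  | push _ he ih =>
    exact ih.tail (rStep_aut (mem_autEdges.2 (.inr (.inl ⟨_, _, _, he, rfl, rfl, rfl⟩))))
  | bal hD hB ih => exact ih.trans (bal_aut hD.mem_controls hB)

theorem Bal.reach (hE : ∀ e, e ∈ E ↔ e ∈ A.edges) {x o z : ℕ} {v : Vec} (h : Bal q₀ E x o z v)
    (w : List ℕ) (m : Vec) :
    PReach A (x, w ++ (if o = 0 then [] else [o - 1]), m) (z, w, m + v) := by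
  induction h generalizing w m with
  | nil =>
    rw [if_pos rfl, List.append_nil, add_zero]
    exact .refl
  | @eps a b z n v he _ _ ih =>
    refine .head (b := (b, w ++ (if 0 = 0 then [] else [0 - 1]), m + n))
      ⟨_, (hE _).1 he, rfl, rfl, rfl, rfl⟩ ?_
    rw [← add_assoc]
    exact ih w _
  | @push a b y z g n v v' he _ _ _ _ ih ih' =>
    refine .head (b := (b, w ++ [g], m + n)) ⟨_, (hE _).1 he, rfl, rfl, rfl, by simp⟩ ?_
    have h₁ := ih (w ++ [g]) (m + n)
    rw [if_pos rfl, List.append_nil] at h₁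
    have h₂ := ih' w (m + n + v)
    rw [if_neg (Nat.succ_ne_zero _), Nat.add_sub_cancel] at h₂
    simpa only [add_assoc] using h₁.trans h₂
  | @pop a b z g n v he _ _ ih =>
    refine .head (b := (b, w, m + n)) ⟨_, (hE _).1 he, rfl, rfl, rfl, by simp⟩ ?_
    have := ih w (m + n)
    rwa [if_pos rfl, List.append_nil, add_assoc] at this

theorem reach_of_run_aut (hE : ∀ e, e ∈ E ↔ e ∈ A.edges) {c : ℕ × List ℕ × Vec}
    (h : Relation.ReflTransGen (RStep (aut A.q0 q E)) c (code q [], w, m)) {p : ℕ}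
    {l : List Item} (hc : c.1 = code p l) :
    ∃ v, MBal A.q0 E l v ∧ PReach A (p, c.2.1, c.2.2 + v) (q, w, m) := by
  induction h using Relation.ReflTransGen.head_induction_on generalizing p l with
  | refl =>
    obtain ⟨rfl, rfl⟩ := code_inj.1 hc
    exact ⟨0, .zero, by rw [add_zero]; exact .refl⟩
  | @head c d hstep _ ih =>
    obtain ⟨c₁, c₂, c₃⟩ := c
    obtain ⟨d₁, d₂, d₃⟩ := d
    obtain ⟨⟨s, ⟨u, n⟩, s'⟩, he, h₁, h₂, h₃, h₄⟩ := hstep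
    replace he : (s, (u, n), s') ∈ autEdges 0 A.q0 E := List.mem_toFinset.1 he
    dsimp only at *
    subst h₁ h₂ h₃ h₄
    rcases mem_autEdges.1 he with ⟨a, b, h, rfl, rfl, rfl⟩ | ⟨a, g, b, h, rfl, rfl, rfl⟩ |
      ⟨a, -, b, -, rfl, rfl, rfl, rfl⟩ | ⟨a, -, t, -, X, l', hr, rfl, rfl, rfl⟩ |
      ⟨a, -, t, -, X, -, rfl, rfl, rfl, rfl⟩ <;> obtain ⟨rfl, rfl⟩ := code_inj.1 hc <;>
      obtain ⟨v, hv, hrun⟩ := ih rfl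
    · refine ⟨v, hv, .head ⟨_, (hE _).1 h, rfl, rfl, ?_, ?_⟩ hrun⟩
      · dsimp only; exact add_right_comm _ _ _
      · simp
    · refine ⟨v, hv, .head ⟨_, (hE _).1 h, rfl, rfl, ?_, rfl⟩ hrun⟩
      dsimp only; exact add_right_comm _ _ _
    · rw [← Multiset.cons_coe] at hv
      obtain ⟨v₁, v₂, hB, hv', rfl⟩ := MBal.cons_iff.1 hv
      refine ⟨v₂, hv', ?_⟩
      have := hB.reach hE c₂ (c₃ + v₂)
      rw [if_pos rfl, List.append_nil, add_assoc, add_comm v₂] at this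
      rw [List.append_nil, add_zero] at hrun
      exact this.trans hrun
    · refine ⟨n + v, hv.of_rule hr, ?_⟩
      rwa [List.append_nil, add_assoc] at hrun
    · refine ⟨v, ?_, ?_⟩
      · have : ((t ++ [X] : List Item) : Multiset Item) = (X :: t : List Item) :=
          Multiset.coe_eq_coe.2 (List.perm_append_singleton X t)
        rwa [this] at hv
      · rwa [List.append_nil, add_zero] at hrun

theorem rLang_aut (hE : ∀ e, e ∈ E ↔ e ∈ A.edges) : RLang (aut A.q0 q E) = ISet A q := by
  ext ⟨w, m⟩
  constructor
  · rintro ⟨qf, hqf, h⟩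
    obtain rfl : qf = code q [] := by simpa [aut] using hqf
    obtain ⟨v, ⟨s, hs, -, rfl⟩, hrun⟩ := reach_of_run_aut hE h rfl
    obtain rfl : s = 0 := by simpa using hs
    change PReach A (A.q0, [], 0) (q, w, m)
    simpa using hrun
  · intro h
    exact ⟨code q [], by simp [aut], (Decomposed.of_reach hE h).run_aut⟩

end Construction

section Computability

open Primrec Encodable

section Primrec

abbrev CodedEdge : Type := ℕ × PLabel × ℕ × ℕ

variable {α : Type*} [Primcodable α] {q₀ q : α → ℕ} {E : α → List CodedEdge} {e : α → CodedEdge}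

theorem primrec_list_pair {σ : Type*} [Primcodable σ] {f g : α → σ} (hf : Primrec f)
    (hg : Primrec g) : Primrec fun a => [f a, g a] :=
  list_cons.comp hf (list_cons.comp hg (const []))

theorem primrec_list_singleton {σ : Type*} [Primcodable σ] {f : α → σ} (hf : Primrec f) :
    Primrec fun a => [f a] :=
  list_cons.comp hf (const [])

theorem primrec_label_cases {σ : Type*} [Primcodable σ] {l : α → PLabel} {f : α → σ}
    {g h : α → ℕ → σ} (hl : Primrec l) (hf : Primrec f) (hg : Primrec₂ g) (hh : Primrec₂ h) :
    Primrec fun a => match l a with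
      | none => f a
      | some (false, n) => g a n
      | some (true, n) => h a n := by
  refine (option_casesOn (g := fun a (x : Bool × ℕ) => bif x.1 then h a x.2 else g a x.2)
    hl hf (cond (fst.comp snd) (hh.comp fst (snd.comp snd))
      (hg.comp fst (snd.comp snd)))).of_eq fun a => ?_
  rcases l a with _ | ⟨_ | _, n⟩ <;> rfl

theorem primrec_tag : Primrec tag :=
  (option_casesOn .id (const 0) (succ.comp (snd.comp snd)).to₂).of_eq fun l => by
    cases l <;> rfl

theorem primrec_controls (hq : Primrec q₀) (hE : Primrec E) :
    Primrec fun a => controls (q₀ a) (E a) :=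
  list_cons.comp hq (list_flatMap hE (primrec_list_pair (fst.comp snd)
    (snd.comp (snd.comp (snd.comp snd)))))

theorem primrec_items (hq : Primrec q₀) (hE : Primrec E) :
    Primrec fun a => items (q₀ a) (E a) :=
  have hC := primrec_controls hq hE
  list_flatMap hC (list_flatMap
    (list_cons.comp (const 0)
      (list_map (hE.comp fst) (primrec_tag.comp (fst.comp (snd.comp snd)))))
    (list_map (hC.comp (fst.comp fst))
      (pair (snd.comp (fst.comp fst)) (pair (snd.comp fst) snd))))

theorem primrec_edgeRules {Q : α → List ℕ} {z : α → ℕ} (hQ : Primrec Q) (he : Primrec e)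
    (hz : Primrec z) : Primrec fun a => edgeRules (Q a) (e a) (z a) := by
  have h₁ := fst.comp he
  have h₂ := fst.comp (snd.comp (snd.comp he))
  have h₃ := snd.comp (snd.comp (snd.comp he))
  exact primrec_label_cases (fst.comp (snd.comp he))
    (primrec_list_singleton (pair (pair h₁ (pair (const 0) hz))
      (pair h₂ (primrec_list_singleton (pair h₃ (pair (const 0) hz))))))
    (list_map (hQ.comp fst) (pair
      (pair (h₁.comp (fst.comp fst)) (pair (const 0) (hz.comp (fst.comp fst))))
      (pair (h₂.comp (fst.comp fst)) (primrec_list_pair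
        (pair (h₃.comp (fst.comp fst)) (pair (const 0) snd))
        (pair snd (pair (succ.comp (snd.comp fst)) (hz.comp (fst.comp fst))))))))
    (primrec_list_singleton (pair (pair (h₁.comp fst) (pair (succ.comp snd) (hz.comp fst)))
      (pair (h₂.comp fst)
        (primrec_list_singleton (pair (h₃.comp fst) (pair (const 0) (hz.comp fst)))))))

theorem primrec_rules {v : ℕ} (hq : Primrec q₀) (hE : Primrec E) :
    Primrec fun a => rules v (q₀ a) (E a) := by
  have hC := primrec_controls hq hE
  exact list_append.comp
    (list_map hC (pair (pair snd (pair (const 0) snd)) (pair (const v) (const []))))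
    (list_flatMap hE (list_flatMap (hC.comp fst)
      (primrec_edgeRules (hC.comp (fst.comp fst)) (snd.comp fst) snd)))

theorem primrec_wordsUpTo {V : α → List Item} {k : α → ℕ} (hV : Primrec V) (hk : Primrec k) :
    Primrec fun a => wordsUpTo (V a) (k a) :=
  nat_rec' hk (const [[]]) (list_cons.comp (const []) (list_flatMap (hV.comp fst)
    (list_map (snd.comp (snd.comp fst)) (list_cons.comp (snd.comp fst) snd).to₂).to₂)).to₂

theorem primrec_indexBound : Primrec indexBound :=
  nat_rec₁ 0 (nat_add.comp (nat_mul.comp (const 2) snd) (const 5))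

theorem primrec_code {l : α → List Item} (hq : Primrec q) (hl : Primrec l) :
    Primrec fun a => code (q a) (l a) :=
  Primrec.encode.comp (pair hq hl)

theorem primrec_controlEdges (he : Primrec e) : Primrec fun a => controlEdges (e a) := by
  have h₁ := primrec_code (fst.comp he) (const [])
  have h₂ := fst.comp (snd.comp (snd.comp he))
  have h₃ := primrec_code (snd.comp (snd.comp (snd.comp he))) (const [])
  exact primrec_label_cases (fst.comp (snd.comp he))
    (primrec_list_singleton (pair h₁ (pair (pair (const []) h₂) h₃)))
    (primrec_list_singleton (pair (h₁.comp fst)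
      (pair (pair (primrec_list_singleton snd) (h₂.comp fst)) (h₃.comp fst))))
    (const [])

theorem primrec_jumpEdges {v : ℕ} {Q : α → List ℕ} (hQ : Primrec Q) :
    Primrec fun a => jumpEdges v (Q a) :=
  list_flatMap hQ (list_map (hQ.comp fst) (pair (primrec_code (snd.comp fst) (const []))
    (pair (const ([], v)) (primrec_code snd
      (primrec_list_singleton (pair (snd.comp fst) (pair (const 0) snd)))))))

theorem primrec_pendingEdges {v : ℕ} {V : α → List Item} {Rs : α → List (Item × ℕ × List Item)}
    {l : α → List Item} (hV : Primrec V) (hR : Primrec Rs) (hq : Primrec q) (hl : Primrec l) :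
    Primrec fun a => pendingEdges v (V a) (Rs a) (q a) (l a) :=
  list_append.comp
    (list_map hR (pair (primrec_code (hq.comp fst) (list_cons.comp (fst.comp snd) (hl.comp fst)))
      (pair (pair (const []) (fst.comp (snd.comp snd)))
        (primrec_code (hq.comp fst)
          (list_append.comp (snd.comp (snd.comp snd)) (hl.comp fst))))))
    (list_map hV (pair (primrec_code (hq.comp fst) (list_cons.comp snd (hl.comp fst)))
      (pair (const ([], v)) (primrec_code (hq.comp fst) (list_concat.comp (hl.comp fst) snd)))))

theorem primrec_autEdges {v : ℕ} (hq : Primrec q₀) (hE : Primrec E) :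
    Primrec fun a => autEdges v (q₀ a) (E a) := by
  have hC := primrec_controls hq hE
  have hI := primrec_items hq hE
  have hR := primrec_rules (v := v) hq hE
  exact list_append.comp (list_flatMap hE (primrec_controlEdges snd))
    (list_append.comp (primrec_jumpEdges hC) (list_flatMap hC (list_flatMap
      ((primrec_wordsUpTo hI (primrec_indexBound.comp (list_length.comp hI))).comp fst)
      (primrec_pendingEdges (hI.comp (fst.comp fst)) (hR.comp (fst.comp fst))
        (snd.comp fst) snd))))

theorem primrec_autStates {v : ℕ} (hq₀ : Primrec q₀) (hq : Primrec q) (hE : Primrec E) :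
    Primrec fun a => autStates v (q₀ a) (q a) (E a) :=
  list_cons.comp (primrec_code hq₀ (const [])) (list_cons.comp (primrec_code hq (const []))
    (list_flatMap (primrec_autEdges hq₀ hE)
      (primrec_list_pair (fst.comp snd) (snd.comp (snd.comp snd)))))

/-- The increasing list of the elements of `l`. -/
def sortDedup (l : List ℕ) : List ℕ := (List.range (l.sum + 1)).filter (· ∈ l)

theorem mem_sortDedup {l : List ℕ} {n : ℕ} : n ∈ sortDedup l ↔ n ∈ l := by
  rw [sortDedup, List.mem_filter, List.mem_range, decide_eq_true_iff, and_iff_right_iff_imp]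
  exact fun h => Nat.lt_succ_of_le (List.le_sum_of_mem h)

theorem pairwise_sortDedup (l : List ℕ) : (sortDedup l).Pairwise (· < ·) :=
  List.Pairwise.filter _ List.pairwise_lt_range

theorem primrec_sortDedup : Primrec sortDedup := by
  have hsum : Primrec fun l : List ℕ => l.sum :=
    list_foldr .id (const 0) (nat_add.comp (fst.comp snd) (snd.comp snd)).to₂
  have hmem : PrimrecRel fun (n : ℕ) (l : List ℕ) => n ∈ l :=
    (Primrec.eq.exists_mem_list.comp snd fst).of_eq (by simp)
  exact hmem.listFilter.comp (list_range.comp (succ.comp hsum)) .id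

abbrev Decoded : Type := List ℕ × List ℕ × List ℕ × List CodedEdge × ℕ × ℕ

/-- The code of the automaton for `I_{A,q}`, where `A` is given by its components. -/
def output (D : Decoded) (q : ℕ) : ℕ :=
  encode (sortDedup (autStates (encodeVec 0) D.2.2.2.2.1 q D.2.2.2.1),
    sortDedup ((autEdges (encodeVec 0) D.2.2.2.2.1 D.2.2.2.1).map fun e =>
      encode (e.1, e.2.1.1, e.2.1.2, e.2.2)),
    code D.2.2.2.2.1 [], [code q []])

def outputOfCode (n : ℕ) : ℕ :=
  ((decode n.unpair.1).map fun D => output D n.unpair.2).getD 0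

theorem primrec_output : Primrec₂ output := by
  have hE : Primrec fun x : Decoded × ℕ => x.1.2.2.2.1 :=
    fst.comp (snd.comp (snd.comp (snd.comp fst)))
  have hq : Primrec fun x : Decoded × ℕ => x.1.2.2.2.2.1 :=
    fst.comp (snd.comp (snd.comp (snd.comp (snd.comp fst))))
  exact Primrec.encode.comp (pair
    (primrec_sortDedup.comp (primrec_autStates hq snd hE))
    (pair (primrec_sortDedup.comp (list_map (primrec_autEdges hq hE)
      (Primrec.encode.comp (pair (fst.comp snd) (pair (fst.comp (fst.comp (snd.comp snd)))
        (pair (snd.comp (fst.comp (snd.comp snd))) (snd.comp (snd.comp snd))))))))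
    (pair (primrec_code hq (const [])) (primrec_list_singleton (primrec_code snd (const []))))))

theorem primrec_outputOfCode : Primrec outputOfCode :=
  option_getD.comp (option_map (Primrec.decode.comp (fst.comp unpair))
    (primrec_output.comp snd (snd.comp (unpair.comp fst)))) (const 0)

end Primrec

section Encoding

variable {α β γ : Type*} [Encodable α]

theorem encode_list_map_congr [Encodable β] {f : γ → α} {g : γ → β}
    (h : ∀ c, encode (f c) = encode (g c)) (l : List γ) : encode (l.map f) = encode (l.map g) := by
  induction l with
  | nil => rfl
  | cons c l ih => rw [List.map_cons, List.map_cons, encode_list_cons, encode_list_cons, h, ih]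

theorem exists_encode_multiset (s : Multiset α) :
    ∃ l : List α, (l : Multiset α) = s ∧ encode s = encode l ∧
      l.Pairwise (fun a b => encode a ≤ encode b) :=
  have : IsLinearOrder α (Order.Preimage encode (· ≤ ·)) :=
    (RelEmbedding.preimage ⟨encode, encode_injective⟩ (· ≤ ·)).isLinearOrder
  ⟨s.sort (Order.Preimage encode (· ≤ ·)), s.sort_eq _, rfl,
    s.pairwise_sort (Order.Preimage encode (· ≤ ·))⟩

theorem encode_multiset_eq {s : Multiset α} (hs : s.Nodup) {l : List ℕ}
    (hl : l.Pairwise (· < ·)) (h : ∀ c, c ∈ l ↔ ∃ a ∈ s, encode a = c) :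
    encode s = encode l := by
  obtain ⟨l', rfl, he, hl'⟩ := exists_encode_multiset s
  have hp : (l'.map encode).Pairwise (· < ·) := by
    refine List.pairwise_map.2 ((hl'.and (Multiset.coe_nodup.1 hs)).imp fun h => ?_)
    exact lt_of_le_of_ne h.1 fun h' => h.2 (encode_injective h')
  have : l'.map encode = l := by
    refine List.Pairwise.eq_of_mem_iff hp hl fun c => ?_
    rw [h, List.mem_map]
    simp
  rw [he, ← this]
  simpa using encode_list_map_congr (f := id) (g := fun a : α => encode a) (fun _ => rfl) l'

theorem exists_map_eq_coe {f : β → γ} {s : Multiset β} {l : List γ} (h : s.map f = l) :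
    ∃ l' : List β, (l' : Multiset β) = s ∧ l'.map f = l := by
  induction l generalizing s with
  | nil => exact ⟨[], (Multiset.map_eq_zero.1 h).symm, rfl⟩
  | cons c l ih =>
    classical
    rw [← Multiset.cons_coe] at h
    obtain ⟨a, ha, rfl, h'⟩ := (Multiset.map_eq_cons _ _ _ _).2 h
    obtain ⟨l', hl', rfl⟩ := ih h'
    refine ⟨a :: l', ?_, rfl⟩
    rw [← Multiset.cons_coe, hl', Multiset.cons_erase ha]

end Encoding

theorem encodeVec_injective : Function.Injective encodeVec := fun _ _ h =>
  Finsupp.graph_injective ℕ ℕ (Finset.val_injective (encode_injective h))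

section Naturality

variable {N M : Type*} (φ : N → M)

def mapEdge (e : ℕ × PLabel × N × ℕ) : ℕ × PLabel × M × ℕ := (e.1, e.2.1, φ e.2.2.1, e.2.2.2)

def mapRule (r : Item × N × List Item) : Item × M × List Item := (r.1, φ r.2.1, r.2.2)

def mapAutEdge (e : ℕ × (List ℕ × N) × ℕ) : ℕ × (List ℕ × M) × ℕ :=
  (e.1, (e.2.1.1, φ e.2.1.2), e.2.2)

variable {q₀ : ℕ} {E : List (ℕ × PLabel × N × ℕ)}

theorem controls_map : controls q₀ (E.map (mapEdge φ)) = controls q₀ E := by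
  simp [controls, List.flatMap_map, mapEdge]

theorem items_map : items q₀ (E.map (mapEdge φ)) = items q₀ E := by
  simp [items, controls_map, mapEdge, Function.comp_def]

theorem edgeRules_map (Q : List ℕ) (e : ℕ × PLabel × N × ℕ) (z : ℕ) :
    edgeRules Q (mapEdge φ e) z = (edgeRules Q e z).map (mapRule φ) := by
  obtain ⟨a, _ | ⟨_ | _, g⟩, n, b⟩ := e <;> simp [edgeRules, mapEdge, mapRule]

theorem rules_map (v : N) :
    rules (φ v) q₀ (E.map (mapEdge φ)) = (rules v q₀ E).map (mapRule φ) := by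
  simp [rules, controls_map, List.flatMap_map, List.map_flatMap, edgeRules_map, mapRule]

theorem controlEdges_map (e : ℕ × PLabel × N × ℕ) :
    controlEdges (mapEdge φ e) = (controlEdges e).map (mapAutEdge φ) := by
  obtain ⟨a, _ | ⟨_ | _, g⟩, n, b⟩ := e <;> simp [controlEdges, mapEdge, mapAutEdge]

theorem jumpEdges_map (v : N) (Q : List ℕ) :
    jumpEdges (φ v) Q = (jumpEdges v Q).map (mapAutEdge φ) := by
  simp [jumpEdges, List.map_flatMap, mapAutEdge, Function.comp_def]

theorem pendingEdges_map (v : N) (V : List Item) (Rs : List (Item × N × List Item)) (p : ℕ)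
    (l : List Item) : pendingEdges (φ v) V (Rs.map (mapRule φ)) p l =
      (pendingEdges v V Rs p l).map (mapAutEdge φ) := by
  simp [pendingEdges, mapAutEdge, mapRule, Function.comp_def]

theorem autEdges_map (v : N) :
    autEdges (φ v) q₀ (E.map (mapEdge φ)) = (autEdges v q₀ E).map (mapAutEdge φ) := by
  simp [autEdges, controls_map, items_map, rules_map, List.flatMap_map, List.map_flatMap,
    controlEdges_map, jumpEdges_map, pendingEdges_map]

theorem autStates_map (v : N) (q : ℕ) :
    autStates (φ v) q₀ q (E.map (mapEdge φ)) = autStates v q₀ q E := by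
  simp [autStates, autEdges_map, List.flatMap_map, mapAutEdge]

end Naturality

theorem encodeRatAut_aut (q₀ q : ℕ) (E : List (ℕ × PLabel × Vec × ℕ)) (a b c : List ℕ) (d : ℕ) :
    encodeRatAut (aut q₀ q E) = output (a, b, c, E.map (mapEdge encodeVec), q₀, d) q := by
  have hinj : Function.Injective fun e : ℕ × (List ℕ × Vec) × ℕ =>
      (e.1, e.2.1.1, encodeVec e.2.1.2, e.2.2) := by
    rintro ⟨s, ⟨w, n⟩, s'⟩ ⟨t, ⟨u, m⟩, t'⟩ h
    simpa [encodeVec_injective.eq_iff, and_assoc] using h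
  have hs : encode (aut q₀ q E).states.val = encode (sortDedup (autStates 0 q₀ q E)) := by
    refine encode_multiset_eq (Finset.nodup _) (pairwise_sortDedup _) fun c => ?_
    simp [mem_sortDedup, aut]
  have he : encode ((aut q₀ q E).edges.val.map
      fun e => (e.1, e.2.1.1, encodeVec e.2.1.2, e.2.2)) =
      encode (sortDedup (((autEdges 0 q₀ E).map (mapAutEdge encodeVec)).map fun e =>
        encode (e.1, e.2.1.1, e.2.1.2, e.2.2))) := by
    refine encode_multiset_eq ((Finset.nodup _).map hinj) (pairwise_sortDedup _) fun c => ?_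
    simp only [mem_sortDedup, aut, List.mem_map, Multiset.mem_map, Finset.mem_val,
      List.mem_toFinset, exists_exists_and_eq_and]
    rfl
  have hf : encode (aut q₀ q E).final.val = encode [code q []] := by
    refine encode_multiset_eq (Finset.nodup _) (List.pairwise_singleton _ _) fun c => ?_
    simp [aut, eq_comm]
  simp only [encodeRatAut, output, autStates_map, autEdges_map, encode_prod_val, hs, he, hf]
  rfl

theorem exists_decoded (A : PDAO) : ∃ (D : Decoded) (E : List (ℕ × PLabel × Vec × ℕ)),
    encodePDAO A = encode D ∧ D.2.2.2.1 = E.map (mapEdge encodeVec) ∧ D.2.2.2.2.1 = A.q0 ∧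
      (E : Multiset _) = A.edges.val := by
  obtain ⟨ls, -, hs, -⟩ := exists_encode_multiset A.states.val
  obtain ⟨lg, -, hg, -⟩ := exists_encode_multiset A.alph.val
  obtain ⟨lo, -, ho, -⟩ := exists_encode_multiset A.out.val
  obtain ⟨le, hle, he, -⟩ := exists_encode_multiset (A.edges.val.map
    (fun e => (e.1, encode e.2.1, encodeVec e.2.2.1, e.2.2.2)))
  obtain ⟨E, hE, rfl⟩ := exists_map_eq_coe hle.symm
  refine ⟨(ls, lg, lo, E.map (mapEdge encodeVec), A.q0, A.qf), E, ?_, rfl, rfl, hE⟩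
  simp only [encodePDAO, encode_prod_val, hs, hg, ho, he]
  rw [encode_list_map_congr (g := mapEdge encodeVec) fun c => by
    simp only [mapEdge, encode_prod_val, encode_nat]]

end Computability

/-- Given a pushdown automaton with output `A` and a state
`q` of `A`, the set `I_{A,q} = {(w, m) : (q0, ε, 0) →* (q, w, m)}` is
rational, and an automaton recognizing it can be effectively constructed
from `A`. -/
theorem ISet_rational :
    ∃ f : ℕ → ℕ, Computable f ∧
      ∀ (A : PDAO) (q : ℕ), q ∈ A.states →
        ∃ B : RatAut,
          f (Nat.pair (encodePDAO A) q) = encodeRatAut B ∧ RLang B = ISet A q := by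
  refine ⟨outputOfCode, primrec_outputOfCode.to_comp, fun A q _ => ?_⟩
  obtain ⟨⟨a, b, c, F, q₀, d⟩, E, hA, rfl, rfl, hE⟩ := exists_decoded A
  refine ⟨aut A.q0 q E, ?_, rLang_aut fun e => ?_⟩
  · rw [encodeRatAut_aut A.q0 q E a b c d, hA, outputOfCode, Nat.unpair_pair, Encodable.encodek]
    rfl
  · rw [← Finset.mem_val, ← hE, Multiset.mem_coe]

end CBL
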